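/- Let S be a sparse collection contained in a dyadic grid D in ℝ^d, let p⃗ ∈ (1,∞)^m with p > 1 where 1/p = Σ_{j=1}^m 1/p_j, and let w⃗ = (w_1,…,w_m) and ω be weights with [w⃗,ω]_{p⃗} < ∞. Set p_0 := p', v_0 := ω^p, and v_j := w_j^{-p_j'} for j = 1,…,m. Then there is a constant c, depending only on d, m and p⃗, such that ( ∫_{ℝ^d} ( Σ_{Q∈S} (∏_{j=0}^{m-1} ⟨v_j⟩_{1,Q}) 1_Q )^{p_m'} v_m dx )^{1/p_m'} ≤ c · [w⃗,ω]_{p⃗} · ( Σ_{Q∈S} (∏_{j=0}^{m-1} ⟨v_j⟩_{1,Q}^{p_m'/p_j}) |Q| )^{1/p_m'}. -/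

import Mathlib

open MeasureTheory ENNReal Set

noncomputable section

namespace Paper

variable {d m : ℕ}

abbrev Rd (d : ℕ) := Fin d → ℝ

structure Cube (d : ℕ) where
  corner : Rd d
  side : ℝ
  side_pos : 0 < side

def Cube.set (Q : Cube d) : Set (Rd d) :=
  {x | ∀ i, Q.corner i ≤ x i ∧ x i < Q.corner i + Q.side}

/-- the average `⟨f⟩_{q,Q}` for finite exponent `q`, of an `ℝ≥0∞`-valued function -/
def eAvg (f : Rd d → ℝ≥0∞) (q : ℝ) (Q : Cube d) : ℝ≥0∞ :=
  ((volume Q.set)⁻¹ * ∫⁻ x in Q.set, f x ^ q) ^ (1 / q)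

def ofFn (f : Rd d → ℝ) : Rd d → ℝ≥0∞ := fun x => ENNReal.ofReal |f x|

/-- the average `⟨f⟩_{q,Q}` for finite exponent `q > 0` -/
def avg (f : Rd d → ℝ) (q : ℝ) (Q : Cube d) : ℝ≥0∞ := eAvg (ofFn f) q Q

/-- the average `⟨f⟩_{q,Q}` for exponent `q ∈ (0,∞]` -/
def avgE (f : Rd d → ℝ) (q : ℝ≥0∞) (Q : Cube d) : ℝ≥0∞ :=
  if q = ∞ then essSup (ofFn f) (volume.restrict Q.set) else avg f q.toReal Q

def IsWeight (u : Rd d → ℝ) : Prop :=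
  MeasureTheory.LocallyIntegrable u volume ∧ ∀ᵐ x ∂(volume : Measure (Rd d)), 0 < u x

/-- `u(A) = ∫_A u dx` -/
def wMeas (u : Rd d → ℝ) (A : Set (Rd d)) : ℝ≥0∞ := ∫⁻ x in A, ENNReal.ofReal (u x)

/-- the Hardy–Littlewood maximal operator -/
def maximal (f : Rd d → ℝ) (x : Rd d) : ℝ≥0∞ :=
  ⨆ (Q : Cube d) (_ : x ∈ Q.set), avg f 1 Q

/-- the Fujii–Wilson constant `[u]_FW` -/
def FW (u : Rd d → ℝ) : ℝ≥0∞ :=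
  ⨆ Q : Cube d, (wMeas u Q.set)⁻¹ * ∫⁻ x in Q.set, maximal (Q.set.indicator u) x

/-- Hölder conjugate in `ℝ≥0∞` -/
def conj (q : ℝ≥0∞) : ℝ≥0∞ := (1 - q⁻¹)⁻¹

def prodW (w : Fin m → Rd d → ℝ) : Rd d → ℝ := fun x => ∏ j, w j x

/-- the two-weight multilinear Muckenhoupt constant `[w⃗,ω]_{p⃗}`; here `p0` is the
real number with `1/p0 = ∑ 1/p j`. -/
def APtw (p0 : ℝ) (p : Fin m → ℝ≥0∞) (w : Fin m → Rd d → ℝ) (ω : Rd d → ℝ) : ℝ≥0∞ :=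
  ⨆ Q : Cube d, avg ω p0 Q * ∏ j, avgE (fun x => (w j x)⁻¹) (conj (p j)) Q

/-- the multilinear Muckenhoupt constant `[w⃗]_{p⃗}` -/
def AP (p0 : ℝ) (p : Fin m → ℝ≥0∞) (w : Fin m → Rd d → ℝ) : ℝ≥0∞ :=
  APtw p0 p w (prodW w)

def IsSparse (η : ℝ) (S : Set (Cube d)) : Prop :=
  ∃ E : Cube d → Set (Rd d),
    (∀ Q ∈ S, E Q ⊆ Q.set ∧ MeasurableSet (E Q) ∧
      ENNReal.ofReal η * volume Q.set ≤ volume (E Q)) ∧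
    S.PairwiseDisjoint E

def dyadicGrid (d : ℕ) (α : Rd d) : Set (Cube d) :=
  {Q | ∃ (j : ℤ) (k : Fin d → ℤ),
    Q.side = (2:ℝ) ^ (-j) ∧ ∀ i, Q.corner i = (2:ℝ) ^ (-j) * (α i + k i)}

def IsDyadicGrid (D : Set (Cube d)) : Prop :=
  ∃ α : Rd d, (∀ i, α i = 0 ∨ α i = 1/3 ∨ α i = 2/3) ∧ D = dyadicGrid d α

/-- bounded, compactly supported, measurable -/
def BCS (f : Rd d → ℝ) : Prop :=
  Measurable f ∧ (∃ C, ∀ x, |f x| ≤ C) ∧ HasCompactSupport f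

def sparseForm (S : Set (Cube d)) (f : Fin m → Rd d → ℝ) (g : Rd d → ℝ) : ℝ≥0∞ :=
  ∑' Q : S, (∏ j, avg (f j) 1 Q.1) * avg g 1 Q.1 * volume (Q.1).set

def SparseFormDom (T : (Fin m → Rd d → ℝ) → Rd d → ℝ) (CT : ℝ≥0∞) : Prop :=
  ∀ (f : Fin m → Rd d → ℝ) (g : Rd d → ℝ), (∀ j, BCS (f j)) → BCS g →
    ∃ S : Set (Cube d), IsSparse (1/2) S ∧
      (∫⁻ x, ofFn (T f) x * ofFn g x) ≤ CT * sparseForm S f g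

/-- `‖f‖_{L^{p,∞}_u} = sup_{λ>0} λ (u^p({f > λ}))^{1/p}` for `ℝ≥0∞`-valued `f` -/
def eWeakNorm (u : Rd d → ℝ) (p : ℝ) (f : Rd d → ℝ≥0∞) : ℝ≥0∞ :=
  ⨆ (l : ℝ) (_ : 0 < l), ENNReal.ofReal l *
    (∫⁻ x in {x | ENNReal.ofReal l < f x}, ENNReal.ofReal (u x) ^ p) ^ (1/p)

def weakNorm (u : Rd d → ℝ) (p : ℝ) (f : Rd d → ℝ) : ℝ≥0∞ := eWeakNorm u p (ofFn f)

/-- `‖f‖_{L^p_u} = ‖fu‖_{L^p}` -/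
def LpW (u : Rd d → ℝ) (p : ℝ≥0∞) (f : Rd d → ℝ) : ℝ≥0∞ :=
  eLpNorm (fun x => f x * u x) p volume

/-- `v_j := w_j^{-p_j'}` -/
def vW (p : Fin m → ℝ≥0∞) (w : Fin m → Rd d → ℝ) (j : Fin m) : Rd d → ℝ :=
  fun x => w j x ^ (-(conj (p j)).toReal)

lemma add_rpow_le_rpow_add (B b : ℝ≥0∞) {r : ℝ} (hr : 1 ≤ r) :
    (B + b) ^ r ≤ B ^ r + ENNReal.ofReal r * (b * (B + b) ^ (r - 1)) := by
  have hr0 : 0 < r := by linarith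
  rcases eq_or_ne b 0 with rfl | hb0
  · simp
  have hr1 : ENNReal.ofReal r ≠ 0 := by simpa using hr0
  rcases eq_or_ne (B + b) ∞ with htop | htop
  · have h1 : (B + b) ^ (r - 1) ≠ 0 := by
      rw [htop]
      rcases eq_or_lt_of_le hr with h | h
      · simp [← h]
      · rw [ENNReal.top_rpow_of_pos (by linarith)]; simp
    rcases ENNReal.add_eq_top.1 htop with h | h
    · rw [h]; simp [ENNReal.top_rpow_of_pos hr0]
    · rw [show b * (B + b) ^ (r - 1) = ∞ by rw [h, ENNReal.top_mul (by simpa [h] using h1)],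
        ENNReal.mul_top hr1]
      simp
  lift B to NNReal using fun h => htop (by simp [h])
  lift b to NNReal using fun h => htop (by simp [h])
  have hb : 0 < (b : ℝ) := by
    have : b ≠ 0 := by simpa using hb0
    positivity
  have hs : 0 < (B : ℝ) + b := by positivity
  have key : ((B : ℝ) + b) ^ r ≤ (B : ℝ) ^ r + r * (b * ((B : ℝ) + b) ^ (r - 1)) := by
    have h := one_add_mul_self_le_rpow_one_add (s := -(b : ℝ) / (B + b))
      (by rw [le_div_iff₀ hs]; linarith [B.coe_nonneg]) hr
    have h2 : 1 + -(b : ℝ) / (B + b) = B / (B + b) := by field_simp; ring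
    rw [h2, Real.div_rpow B.coe_nonneg hs.le, le_div_iff₀ (by positivity)] at h
    have h3 : ((B : ℝ) + b) ^ r = (B + b) * ((B : ℝ) + b) ^ (r - 1) := by
      rw [mul_comm, ← Real.rpow_add_one hs.ne']; congr 1; ring
    have h4 : (1 + r * (-(b : ℝ) / (B + b))) * ((B : ℝ) + b) ^ r
        = ((B : ℝ) + b) ^ r - r * (b * ((B : ℝ) + b) ^ (r - 1)) := by
      rw [h3]; field_simp; ring
    linarith
  have hofr : ENNReal.ofReal r = ((Real.toNNReal r : NNReal) : ℝ≥0∞) := rfl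
  rw [hofr, ← ENNReal.coe_add, ← ENNReal.coe_rpow_of_nonneg _ hr0.le,
    ← ENNReal.coe_rpow_of_nonneg _ hr0.le, ← ENNReal.coe_rpow_of_nonneg _ (by linarith : 0 ≤ r - 1)]
  norm_cast
  rw [← NNReal.coe_le_coe]
  push_cast
  rw [Real.coe_toNNReal r hr0.le]
  exact key

lemma sum_rpow_le_sum_mul_rpow {ι : Type*} (s : Finset ι) (b : ι → ℝ≥0∞) (h : ι → ℝ)
    {r : ℝ} (hr : 1 ≤ r) :
    (∑ i ∈ s, b i) ^ r ≤
      ENNReal.ofReal r * ∑ i ∈ s, b i * (∑ j ∈ s with h j ≤ h i, b j) ^ (r - 1) := by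
  classical
  induction hn : s.card generalizing s with
  | zero =>
    rw [Finset.card_eq_zero] at hn
    subst hn
    simp [ENNReal.zero_rpow_of_pos (by linarith : 0 < r)]
  | succ n ih =>
    have hne : s.Nonempty := by rw [← Finset.card_pos]; omega
    obtain ⟨i, hi, hmax⟩ := s.exists_max_image h hne
    have h1 := ih (s.erase i) (by rw [Finset.card_erase_of_mem hi]; omega)
    rw [← Finset.sum_erase_add s _ hi]
    refine (add_rpow_le_rpow_add _ _ hr).trans ?_
    rw [← Finset.sum_erase_add s (fun i => b i * (∑ j ∈ s with h j ≤ h i, b j) ^ (r - 1)) hi,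
      mul_add]
    refine add_le_add (h1.trans ?_) ?_
    · gcongr with k hk
      exact Finset.erase_subset _ _
    · rw [Finset.sum_erase_add s _ hi, Finset.filter_true_of_mem (fun j hj => hmax j hj)]

lemma measure_biUnion_le_of_nested {X ι : Type*} [MeasurableSpace X] (μ ν : Measure X)
    (T : Finset ι) (B : ι → Set X) (h : ι → ℝ) (hB : ∀ i ∈ T, MeasurableSet (B i))
    (hnest : ∀ i ∈ T, ∀ j ∈ T, h j ≤ h i → B j ⊆ B i ∨ Disjoint (B j) (B i))
    (hle : ∀ i ∈ T, μ (B i) ≤ ν (B i)) :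
    μ (⋃ i ∈ T, B i) ≤ ν (⋃ i ∈ T, B i) := by
  classical
  induction hn : T.card using Nat.strong_induction_on generalizing T with
  | _ n ih =>
    rcases T.eq_empty_or_nonempty with rfl | hne
    · simp
    obtain ⟨i, hi, hmax⟩ := T.exists_max_image h hne
    set U := T.filter (fun j => ¬ B j ⊆ B i) with hU
    have hUT : ∀ j ∈ U, j ∈ T := fun j hj => (Finset.mem_filter.1 hj).1
    have hcard : U.card < n := by
      rw [← hn]
      exact Finset.card_lt_card (Finset.filter_ssubset.2 ⟨i, hi, by simp⟩)
    have hunion : (⋃ j ∈ T, B j) = B i ∪ ⋃ j ∈ U, B j := by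
      ext x
      simp only [mem_iUnion, mem_union, exists_prop]
      constructor
      · rintro ⟨j, hj, hx⟩
        by_cases hji : B j ⊆ B i
        · exact Or.inl (hji hx)
        · exact Or.inr ⟨j, Finset.mem_filter.2 ⟨hj, hji⟩, hx⟩
      · rintro (hx | ⟨j, hj, hx⟩)
        · exact ⟨i, hi, hx⟩
        · exact ⟨j, hUT j hj, hx⟩
    have hdisj : Disjoint (B i) (⋃ j ∈ U, B j) := by
      simp only [disjoint_iUnion_right]
      intro j hj
      have hj' := Finset.mem_filter.1 hj
      exact ((hnest i hi j hj'.1 (hmax j hj'.1)).resolve_left hj'.2).symm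
    have h1 := ih U.card hcard U (fun j hj => hB j (hUT j hj))
      (fun j hj k hk => hnest j (hUT j hj) k (hUT k hk)) (fun j hj => hle j (hUT j hj)) rfl
    rw [hunion, measure_union hdisj (Finset.measurableSet_biUnion _ fun j hj => hB j (hUT j hj)),
      measure_union hdisj (Finset.measurableSet_biUnion _ fun j hj => hB j (hUT j hj))]
    exact add_le_add (hle i hi) h1

lemma rpow_le_one_add_tsum {t : ℝ≥0∞} (ht : t ≠ ∞) {γ : ℝ} (hγ : 0 ≤ γ) :
    t ^ γ ≤ 1 + ∑' k : ℕ, if (2 : ℝ≥0∞) ^ k ≤ t then (2 : ℝ≥0∞) ^ (γ * (k + 1)) else 0 := by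
  rcases le_total t 1 with h1 | h1
  · exact (ENNReal.rpow_le_one h1 hγ).trans le_self_add
  lift t to NNReal using ht
  obtain ⟨k, hk1, hk2⟩ := exists_nat_pow_near (x := t) (y := 2) (by exact_mod_cast h1)
    one_lt_two
  refine le_trans ?_ ((ENNReal.le_tsum k).trans le_add_self)
  rw [if_pos (by exact_mod_cast hk1), mul_comm, ENNReal.rpow_mul]
  refine ENNReal.rpow_le_rpow ?_ hγ
  rw [show ((k : ℝ) + 1) = ((k + 1 : ℕ) : ℝ) by push_cast; ring, ENNReal.rpow_natCast]
  exact_mod_cast hk2.le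

lemma exists_sum_rpow_average_le {X ι : Type*} [MeasurableSpace X] {γ : ℝ} (hγ : 0 ≤ γ)
    (hγ1 : γ < 1) :
    ∃ C : ℝ≥0∞, C ≠ ∞ ∧ ∀ (μ ν : Measure X) (T : Finset ι) (B E : ι → Set X) (h : ι → ℝ)
      (Q : Set X) (a : ι → ℝ≥0∞) (aQ : ℝ≥0∞),
      (∀ i ∈ T, MeasurableSet (B i)) → (∀ i ∈ T, MeasurableSet (E i)) →
      (∀ i ∈ T, E i ⊆ B i) → ((T : Set ι).PairwiseDisjoint E) →
      (∀ i ∈ T, μ (B i) ≤ 2 * μ (E i)) →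
      (∀ i ∈ T, ∀ j ∈ T, h j ≤ h i → B j ⊆ B i ∨ Disjoint (B j) (B i)) →
      (∀ i ∈ T, B i ⊆ Q) → (∀ i ∈ T, ν (B i) = a i * μ (B i)) → ν Q ≤ aQ * μ Q →
      (∀ i ∈ T, a i ≠ ∞) → aQ ≠ 0 → aQ ≠ ∞ →
      ∑ i ∈ T, (a i / aQ) ^ γ * μ (B i) ≤ C * μ Q := by
  classical
  set S : ℝ≥0∞ := ∑' k : ℕ, (2 : ℝ≥0∞) ^ (γ * (k + 1)) * ((2 : ℝ≥0∞) ^ k)⁻¹ with hS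
  have hSfin : S ≠ ∞ := by
    have : S = ∑' k : ℕ, (2 : ℝ≥0∞) ^ γ * ((2 : ℝ≥0∞) ^ (γ - 1)) ^ k := by
      rw [hS]
      congr 1; ext k
      rw [← ENNReal.rpow_natCast, ← ENNReal.rpow_natCast, ← ENNReal.rpow_neg,
        ← ENNReal.rpow_add _ _ two_ne_zero ofNat_ne_top, ← ENNReal.rpow_mul,
        ← ENNReal.rpow_add _ _ two_ne_zero ofNat_ne_top]
      congr 1; ring
    rw [this, ENNReal.tsum_mul_left, ENNReal.tsum_geometric]
    refine ENNReal.mul_ne_top (by simp) (ENNReal.inv_ne_top.2 ?_)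
    rw [← pos_iff_ne_zero, tsub_pos_iff_lt]
    exact ENNReal.rpow_lt_one_of_one_lt_of_neg one_lt_two (by linarith)
  refine ⟨2 * (1 + S), ENNReal.mul_ne_top (by simp) (by simp [hSfin]), ?_⟩
  intro μ ν T B E h Q a aQ hB hE hEB hdisj hsp hnest hBQ hν hνQ ha haQ0 haQ
  have hsum : ∀ U ⊆ T, ∑ i ∈ U, μ (E i) ≤ μ (⋃ i ∈ U, B i) := by
    intro U hU
    rw [← measure_biUnion_finset (fun i hi j hj hij => hdisj (hU hi) (hU hj) hij)
      (fun i hi => hE i (hU hi))]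
    exact measure_mono (iUnion₂_mono fun i hi => hEB i (hU hi))
  have hlevel : ∀ k : ℕ, ∑ i ∈ T with (2 : ℝ≥0∞) ^ k ≤ a i / aQ, μ (E i)
      ≤ ((2 : ℝ≥0∞) ^ k)⁻¹ * μ Q := by
    intro k
    set U := T.filter (fun i => (2 : ℝ≥0∞) ^ k ≤ a i / aQ)
    have hUT : U ⊆ T := Finset.filter_subset _ _
    refine (hsum U hUT).trans ?_
    have h1 : (((2 : ℝ≥0∞) ^ k * aQ) • μ) (⋃ i ∈ U, B i) ≤ ν (⋃ i ∈ U, B i) := by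
      refine measure_biUnion_le_of_nested _ _ U B h (fun i hi => hB i (hUT hi))
        (fun i hi j hj => hnest i (hUT hi) j (hUT hj)) fun i hi => ?_
      rw [hν i (hUT hi), Measure.smul_apply, smul_eq_mul]
      gcongr
      have := (Finset.mem_filter.1 hi).2
      rwa [ENNReal.le_div_iff_mul_le (Or.inl haQ0) (Or.inl haQ)] at this
    have h2 : ν (⋃ i ∈ U, B i) ≤ aQ * μ Q :=
      (measure_mono (iUnion₂_subset fun i hi => hBQ i (hUT hi))).trans hνQ
    have h3 := h1.trans h2
    rw [Measure.smul_apply, smul_eq_mul, mul_comm (2 ^ k) aQ, mul_assoc,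
      ENNReal.mul_le_mul_iff_right haQ0 haQ] at h3
    rw [mul_comm, ← div_eq_mul_inv, ENNReal.le_div_iff_mul_le (by simp) (by simp), mul_comm]
    exact h3
  calc ∑ i ∈ T, (a i / aQ) ^ γ * μ (B i)
      ≤ ∑ i ∈ T, (1 + ∑' k : ℕ, if (2 : ℝ≥0∞) ^ k ≤ a i / aQ then
          (2 : ℝ≥0∞) ^ (γ * (k + 1)) else 0) * (2 * μ (E i)) := by
        gcongr with i hi
        · exact rpow_le_one_add_tsum (ENNReal.div_ne_top (ha i hi) haQ0) hγ
        · exact hsp i hi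
    _ = 2 * (∑ i ∈ T, μ (E i) + ∑' k : ℕ, (2 : ℝ≥0∞) ^ (γ * (k + 1)) *
          ∑ i ∈ T with (2 : ℝ≥0∞) ^ k ≤ a i / aQ, μ (E i)) := by
        simp_rw [add_mul, Finset.sum_add_distrib, mul_add, ← ENNReal.tsum_mul_right]
        rw [← Summable.tsum_finsetSum (fun _ _ => ENNReal.summable), ← ENNReal.tsum_mul_left]
        congr 1
        · rw [Finset.mul_sum]; simp
        · congr 1; ext k
          rw [Finset.sum_filter, Finset.mul_sum, Finset.mul_sum]
          refine Finset.sum_congr rfl fun i _ => ?_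
          split_ifs
          · ring
          · simp
    _ ≤ 2 * (μ Q + ∑' k : ℕ, (2 : ℝ≥0∞) ^ (γ * (k + 1)) * (((2 : ℝ≥0∞) ^ k)⁻¹ * μ Q)) := by
        gcongr with k
        · exact (hsum T subset_rfl).trans (measure_mono (iUnion₂_subset hBQ))
        · exact hlevel k
    _ = 2 * (1 + S) * μ Q := by
        simp_rw [← mul_assoc, ENNReal.tsum_mul_right]
        ring

lemma prod_rpow_le_sum_rpow {κ : Type*} [Fintype κ] [Nonempty κ] (t : κ → ℝ≥0∞) (γ : κ → ℝ)
    (hγ : ∀ j, 0 ≤ γ j) : ∏ j, t j ^ γ j ≤ ∑ j, t j ^ (∑ k, γ k) := by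
  classical
  obtain ⟨j0, -, hmax⟩ := Finset.univ.exists_max_image t Finset.univ_nonempty
  have hpow : ∀ s : Finset κ, ∏ j ∈ s, t j0 ^ γ j = t j0 ^ (∑ k ∈ s, γ k) := by
    intro s
    induction s using Finset.induction_on with
    | empty => simp
    | insert i s hi ih =>
      rw [Finset.prod_insert hi, Finset.sum_insert hi, ih,
        ENNReal.rpow_add_of_nonneg _ _ (hγ i) (Finset.sum_nonneg fun k _ => hγ k)]
  calc ∏ j, t j ^ γ j ≤ ∏ j, t j0 ^ γ j :=
        Finset.prod_le_prod' fun j _ => ENNReal.rpow_le_rpow (hmax j (Finset.mem_univ j)) (hγ j)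
    _ = t j0 ^ (∑ k, γ k) := hpow _
    _ ≤ _ := Finset.single_le_sum (f := fun j => t j ^ (∑ k, γ k)) (fun _ _ => zero_le)
        (Finset.mem_univ j0)

lemma exists_sum_prod_rpow_average_le {X ι κ : Type*} [MeasurableSpace X] [Fintype κ] [Nonempty κ]
    {γ : κ → ℝ} (hγ : ∀ j, 0 ≤ γ j) (hγ1 : ∑ j, γ j < 1) :
    ∃ C : ℝ≥0∞, C ≠ ∞ ∧ ∀ (μ : Measure X) (ν : κ → Measure X) (T : Finset ι) (B E : ι → Set X)
      (h : ι → ℝ) (Q : Set X) (a : κ → ι → ℝ≥0∞) (aQ : κ → ℝ≥0∞),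
      (∀ i ∈ T, MeasurableSet (B i)) → (∀ i ∈ T, MeasurableSet (E i)) →
      (∀ i ∈ T, E i ⊆ B i) → ((T : Set ι).PairwiseDisjoint E) →
      (∀ i ∈ T, μ (B i) ≤ 2 * μ (E i)) →
      (∀ i ∈ T, ∀ j ∈ T, h j ≤ h i → B j ⊆ B i ∨ Disjoint (B j) (B i)) →
      (∀ i ∈ T, B i ⊆ Q) → (∀ k, ∀ i ∈ T, ν k (B i) = a k i * μ (B i)) →
      (∀ k, ν k Q ≤ aQ k * μ Q) →
      (∀ k, ∀ i ∈ T, a k i ≠ ∞) → (∀ k, aQ k ≠ 0) → (∀ k, aQ k ≠ ∞) →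
      ∑ i ∈ T, (∏ k, a k i ^ γ k) * μ (B i) ≤ C * ((∏ k, aQ k ^ γ k) * μ Q) := by
  obtain ⟨C, hC, H⟩ := exists_sum_rpow_average_le (X := X) (ι := ι)
    (Finset.sum_nonneg fun j _ => hγ j) hγ1
  refine ⟨Fintype.card κ * C, ENNReal.mul_ne_top (by simp) hC, ?_⟩
  intro μ ν T B E h Q a aQ hB hE hEB hdisj hsp hnest hBQ hν hνQ ha haQ0 haQ
  calc ∑ i ∈ T, (∏ k, a k i ^ γ k) * μ (B i)
      = ∑ i ∈ T, (∏ k, aQ k ^ γ k) * ((∏ k, (a k i / aQ k) ^ γ k) * μ (B i)) := by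
        refine Finset.sum_congr rfl fun i _ => ?_
        rw [← mul_assoc, ← Finset.prod_mul_distrib]
        congr 1
        refine Finset.prod_congr rfl fun k _ => ?_
        rw [← ENNReal.mul_rpow_of_nonneg _ _ (hγ k), ENNReal.mul_div_cancel (haQ0 k) (haQ k)]
    _ ≤ ∑ i ∈ T, (∏ k, aQ k ^ γ k) * ((∑ k, (a k i / aQ k) ^ (∑ l, γ l)) * μ (B i)) := by
        gcongr with i hi
        exact prod_rpow_le_sum_rpow _ _ hγ
    _ = (∏ k, aQ k ^ γ k) * ∑ k, ∑ i ∈ T, (a k i / aQ k) ^ (∑ l, γ l) * μ (B i) := by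
        rw [← Finset.mul_sum, Finset.sum_comm]
        simp_rw [Finset.sum_mul]
    _ ≤ (∏ k, aQ k ^ γ k) * ∑ _k : κ, C * μ Q := by
        gcongr with k
        exact H μ (ν k) T B E h Q (a k) (aQ k) hB hE hEB hdisj hsp hnest hBQ (hν k) (hνQ k)
          (ha k) (haQ0 k) (haQ k)
    _ = _ := by
        rw [Finset.sum_const, nsmul_eq_mul, Finset.card_univ]
        ring

lemma setLIntegral_rpow_le {X : Type*} [MeasurableSpace X] (μ : Measure X) (B : Set X)
    (hB0 : μ B ≠ 0) (hB : μ B ≠ ∞) {f : X → ℝ≥0∞} (hf : AEMeasurable f (μ.restrict B)) {s : ℝ}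
    (hs : 0 ≤ s) (hs1 : s ≤ 1) :
    ∫⁻ x in B, f x ^ s ∂μ ≤ μ B * ((μ B)⁻¹ * ∫⁻ x in B, f x ∂μ) ^ s := by
  have h := ENNReal.lintegral_mul_norm_pow_le (μ := μ.restrict B) (f := f) (g := fun _ => 1)
    hf aemeasurable_const hs (by linarith : 0 ≤ 1 - s) (by ring)
  simp only [ENNReal.one_rpow, mul_one, lintegral_const, Measure.restrict_apply, MeasurableSet.univ,
    univ_inter, one_mul] at h
  refine h.trans (le_of_eq ?_)
  rw [ENNReal.mul_rpow_of_nonneg _ _ hs, ← mul_assoc, mul_comm, ENNReal.rpow_sub _ _ hB0 hB,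
    ENNReal.rpow_one, ENNReal.inv_rpow]
  rfl

lemma rpow_mul_le_add_rpow (G L : ℝ≥0∞) {ε : ℝ≥0∞} (hε : ε ≠ 0) (hε' : ε ≠ ∞) {s : ℝ}
    (hs : 0 < s) : G ^ s * L ≤ ε * G ^ (s + 1) + (ε⁻¹) ^ s * L ^ (s + 1) := by
  rcases le_total L (ε * G) with h | h
  · refine le_trans ?_ le_self_add
    calc G ^ s * L ≤ G ^ s * (ε * G) := by gcongr
      _ = ε * G ^ (s + 1) := by
        rw [ENNReal.rpow_add_of_nonneg _ _ hs.le zero_le_one, ENNReal.rpow_one]; ring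
  · refine le_trans ?_ le_add_self
    have hG : G ≤ ε⁻¹ * L := by
      rw [mul_comm, ← div_eq_mul_inv, ENNReal.le_div_iff_mul_le (Or.inl hε) (Or.inl hε'), mul_comm]
      exact h
    calc G ^ s * L ≤ (ε⁻¹ * L) ^ s * L := by gcongr
      _ = (ε⁻¹) ^ s * L ^ (s + 1) := by
        rw [ENNReal.rpow_add_of_nonneg _ _ hs.le zero_le_one, ENNReal.rpow_one,
          ENNReal.mul_rpow_of_nonneg _ _ hs.le]
        ring

open scoped Classical in
lemma lintegral_sum_rpow_le_of_le_two {X ι : Type*} [MeasurableSpace X] {r : ℝ} (hr : 1 < r)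
    (hr2 : r ≤ 2) (μ : Measure X) (T : Finset ι) (B : ι → Set X) (h : ι → ℝ) (c : ι → ℝ≥0∞)
    (hB : ∀ i ∈ T, MeasurableSet (B i))
    (hnest : ∀ i ∈ T, ∀ j ∈ T, h j ≤ h i → B j ⊆ B i ∨ Disjoint (B j) (B i))
    (hμ0 : ∀ i ∈ T, μ (B i) ≠ 0) (hμ : ∀ i ∈ T, μ (B i) ≠ ∞) :
    ∫⁻ x, (∑ i ∈ T, c i * (B i).indicator (fun _ => (1 : ℝ≥0∞)) x) ^ r ∂μ ≤
      ENNReal.ofReal r * ∑ i ∈ T, c i * (μ (B i) *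
        ((μ (B i))⁻¹ * ∑ j ∈ T with B j ⊆ B i, c j * μ (B j)) ^ (r - 1)) := by
  set f : ι → X → ℝ≥0∞ := fun i x =>
    ∑ j ∈ T with B j ⊆ B i, c j * (B j).indicator (fun _ => (1 : ℝ≥0∞)) x with hf
  have hfm : ∀ i, Measurable (f i) := fun i => Finset.measurable_fun_sum _ fun j hj =>
    (measurable_const.indicator (hB j (Finset.mem_filter.1 hj).1)).const_mul _
  have hpt : ∀ x, (∑ i ∈ T, c i * (B i).indicator (fun _ => (1 : ℝ≥0∞)) x) ^ r ≤
      ENNReal.ofReal r * ∑ i ∈ T, c i * (B i).indicator (fun x => f i x ^ (r - 1)) x := by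
    intro x
    refine (sum_rpow_le_sum_mul_rpow T _ h hr.le).trans ?_
    refine mul_le_mul_right (Finset.sum_le_sum fun i hi => ?_) _
    by_cases hx : x ∈ B i
    · simp only [indicator_of_mem hx, mul_one]
      refine mul_le_mul_right (ENNReal.rpow_le_rpow ?_ (by linarith)) _
      rw [hf]
      simp only [Finset.sum_filter]
      refine Finset.sum_le_sum fun j hj => ?_
      by_cases hxj : x ∈ B j
      · split_ifs with h1 h2
        · rfl
        · rcases hnest i hi j hj h1 with h3 | h3
          · exact absurd h3 h2
          · exact absurd hx (disjoint_left.1 h3 hxj)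
        · exact zero_le
        · exact zero_le
      · simp [indicator_of_notMem hxj]
    · simp [indicator_of_notMem hx]
  refine (lintegral_mono hpt).trans ?_
  rw [lintegral_const_mul' _ _ ENNReal.ofReal_ne_top,
    lintegral_finsetSum' _ fun i hi => (((hfm i).pow_const _).indicator (hB i hi)).const_mul _
      |>.aemeasurable]
  refine mul_le_mul_right (Finset.sum_le_sum fun i hi => ?_) _
  rw [lintegral_const_mul _ (((hfm i).pow_const _).indicator (hB i hi)),
    lintegral_indicator (hB i hi)]
  refine mul_le_mul_right ((setLIntegral_rpow_le μ (B i) (hμ0 i hi) (hμ i hi)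
    (hfm i).aemeasurable (by linarith) (by linarith)).trans ?_) _
  gcongr
  refine (setLIntegral_le_lintegral _ _).trans ?_
  rw [hf, lintegral_finsetSum' _ fun j hj => ((measurable_const.indicator
    (hB j (Finset.mem_filter.1 hj).1)).const_mul _).aemeasurable]
  refine Finset.sum_le_sum fun j hj => ?_
  have hBj := hB j (Finset.mem_filter.1 hj).1
  rw [lintegral_const_mul _ (measurable_const.indicator hBj), lintegral_indicator hBj]
  simp

open scoped Classical in
lemma lintegral_sum_rpow_le_of_two_lt {X ι : Type*} [MeasurableSpace X] {r : ℝ} (hr : 2 < r)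
    (μ : Measure X) (T : Finset ι) (B : ι → Set X) (h : ι → ℝ) (c : ι → ℝ≥0∞)
    (hB : ∀ i ∈ T, MeasurableSet (B i))
    (hnest : ∀ i ∈ T, ∀ j ∈ T, h j ≤ h i → B j ⊆ B i ∨ Disjoint (B j) (B i))
    (hμ0 : ∀ i ∈ T, μ (B i) ≠ 0) (hμ : ∀ i ∈ T, μ (B i) ≠ ∞) (hc : ∀ i ∈ T, c i ≠ ∞) :
    ∫⁻ x, (∑ i ∈ T, c i * (B i).indicator (fun _ => (1 : ℝ≥0∞)) x) ^ r ∂μ ≤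
      ENNReal.ofReal r * (2 * (ENNReal.ofReal (r - 1) *
        ((2 * ENNReal.ofReal (r - 1)) ^ (r - 2)))) * ∑ i ∈ T, c i * (μ (B i) *
        ((μ (B i))⁻¹ * ∑ j ∈ T with B j ⊆ B i, c j * μ (B j)) ^ (r - 1)) := by
  set L : ι → ℝ≥0∞ := fun i => (μ (B i))⁻¹ * ∑ j ∈ T with B j ⊆ B i, c j * μ (B j) with hL
  set G : ι → ℝ≥0∞ := fun i => ∑ j ∈ T with B i ⊆ B j, c j with hG
  set Z : ℝ≥0∞ := ∑ i ∈ T, c i * (μ (B i) * G i ^ (r - 1)) with hZ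
  set Y : ℝ≥0∞ := ∑ i ∈ T, c i * (μ (B i) * L i ^ (r - 1)) with hY
  have hGtop : ∀ i, G i ≠ ∞ := fun i =>
    ENNReal.sum_ne_top.2 fun j hj => hc j (Finset.mem_filter.1 hj).1
  have hZtop : Z ≠ ∞ := ENNReal.sum_ne_top.2 fun i hi => ENNReal.mul_ne_top (hc i hi)
    (ENNReal.mul_ne_top (hμ i hi) (ENNReal.rpow_ne_top_of_nonneg (by linarith) (hGtop i)))
  have hmem : ∀ x, ∀ i ∈ T, ∀ j ∈ T, x ∈ B i → x ∈ B j → -h j ≤ -h i → B i ⊆ B j := by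
    intro x i hi j hj hxi hxj hij
    rcases hnest j hj i hi (by linarith) with h3 | h3
    · exact h3
    · exact absurd hxj (disjoint_left.1 h3 hxi)
  have hint : ∫⁻ x, (∑ i ∈ T, c i * (B i).indicator (fun _ => (1 : ℝ≥0∞)) x) ^ r ∂μ ≤
      ENNReal.ofReal r * Z := by
    have hpt : ∀ x, (∑ i ∈ T, c i * (B i).indicator (fun _ => (1 : ℝ≥0∞)) x) ^ r ≤
        ENNReal.ofReal r * ∑ i ∈ T, c i * (B i).indicator (fun _ => G i ^ (r - 1)) x := by
      intro x
      refine (sum_rpow_le_sum_mul_rpow T _ (fun i => -h i) (by linarith)).trans ?_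
      refine mul_le_mul_right (Finset.sum_le_sum fun i hi => ?_) _
      by_cases hx : x ∈ B i
      · simp only [indicator_of_mem hx, mul_one]
        refine mul_le_mul_right (ENNReal.rpow_le_rpow ?_ (by linarith)) _
        rw [hG]
        simp only [Finset.sum_filter]
        refine Finset.sum_le_sum fun j hj => ?_
        by_cases hxj : x ∈ B j
        · split_ifs with h1 h2
          · simp [indicator_of_mem hxj]
          · exact absurd (hmem x i hi j hj hx hxj h1) h2
          · exact zero_le
          · exact zero_le
        · simp [indicator_of_notMem hxj]
      · simp [indicator_of_notMem hx]
    refine (lintegral_mono hpt).trans ?_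
    rw [lintegral_const_mul' _ _ ENNReal.ofReal_ne_top,
      lintegral_finsetSum' _ fun i hi => ((measurable_const.indicator (hB i hi)).const_mul _)
        |>.aemeasurable]
    refine mul_le_mul_right (Finset.sum_le_sum fun i hi => ?_) _
    rw [lintegral_const_mul _ (measurable_const.indicator (hB i hi)),
      lintegral_indicator (hB i hi)]
    simp [mul_comm]
  have hGpow : ∀ i ∈ T, G i ^ (r - 1) ≤ ENNReal.ofReal (r - 1) *
      ∑ j ∈ T with B i ⊆ B j, c j * G j ^ (r - 2) := by
    intro i hi
    obtain ⟨x, hx⟩ := nonempty_of_measure_ne_zero (hμ0 i hi)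
    refine (sum_rpow_le_sum_mul_rpow _ c (fun i => -h i) (by linarith)).trans ?_
    rw [show r - 1 - 1 = r - 2 by ring]
    refine mul_le_mul_right (Finset.sum_le_sum fun j hj => ?_) _
    refine mul_le_mul_right (ENNReal.rpow_le_rpow ?_ (by linarith)) _
    refine Finset.sum_le_sum_of_subset fun k hk => ?_
    simp only [Finset.mem_filter] at hk hj ⊢
    exact ⟨hk.1.1, hmem x j hj.1 k hk.1.1 (hj.2 hx) (hk.1.2 hx) hk.2⟩
  have hr1 : ENNReal.ofReal (r - 1) ≠ 0 := by simp; linarith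
  set R : ℝ≥0∞ := ENNReal.ofReal (r - 1) with hR
  have hRtop : R ≠ ∞ := ENNReal.ofReal_ne_top
  have hZle : Z ≤ 2⁻¹ * Z + R * ((2 * R) ^ (r - 2) * Y) := by
    calc Z ≤ ∑ i ∈ T, c i * (μ (B i) * (R * ∑ j ∈ T with B i ⊆ B j, c j * G j ^ (r - 2))) := by
          rw [hZ]
          gcongr with i hi
          exact hGpow i hi
      _ = R * ∑ j ∈ T, c j * G j ^ (r - 2) * ∑ i ∈ T with B i ⊆ B j, c i * μ (B i) := by
          simp only [Finset.sum_filter, Finset.mul_sum]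
          rw [Finset.sum_comm]
          refine Finset.sum_congr rfl fun j _ => Finset.sum_congr rfl fun i _ => ?_
          split_ifs
          · ring
          · simp
      _ = R * ∑ j ∈ T, c j * (μ (B j) * (G j ^ (r - 2) * L j)) := by
          congr 1
          refine Finset.sum_congr rfl fun j hj => ?_
          rw [hL]
          simp only
          rw [show c j * (μ (B j) * (G j ^ (r - 2) * ((μ (B j))⁻¹ *
              ∑ i ∈ T with B i ⊆ B j, c i * μ (B i)))) = (μ (B j) * (μ (B j))⁻¹) *
              (c j * G j ^ (r - 2) * ∑ i ∈ T with B i ⊆ B j, c i * μ (B i)) by ring,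
            ENNReal.mul_inv_cancel (hμ0 j hj) (hμ j hj), one_mul]
      _ ≤ R * ∑ j ∈ T, c j * (μ (B j) * ((2 * R)⁻¹ * G j ^ (r - 1) +
            (2 * R) ^ (r - 2) * L j ^ (r - 1))) := by
          gcongr with j hj
          have := rpow_mul_le_add_rpow (G j) (L j) (ε := (2 * R)⁻¹)
            (ENNReal.inv_ne_zero.2 (ENNReal.mul_ne_top (by simp) hRtop))
            (ENNReal.inv_ne_top.2 (mul_ne_zero (by simp) hr1)) (s := r - 2) (by linarith)
          rwa [inv_inv, show r - 2 + 1 = r - 1 by ring] at this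
      _ = R * (2 * R)⁻¹ * Z + R * ((2 * R) ^ (r - 2) * Y) := by
          rw [hZ, hY, mul_assoc, ← mul_add]
          congr 1
          rw [Finset.mul_sum, Finset.mul_sum, ← Finset.sum_add_distrib]
          refine Finset.sum_congr rfl fun j _ => ?_
          ring
      _ = _ := by
          rw [ENNReal.mul_inv (Or.inl (by simp)) (Or.inl (by simp)), mul_left_comm,
            ENNReal.mul_inv_cancel hr1 hRtop, mul_one]
  have hZY : Z ≤ 2 * (R * ((2 * R) ^ (r - 2) * Y)) := by
    have h1 : Z = 2⁻¹ * Z + 2⁻¹ * Z := by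
      rw [← add_mul, ENNReal.inv_two_add_inv_two, one_mul]
    have h2 : 2⁻¹ * Z ≤ R * ((2 * R) ^ (r - 2) * Y) := by
      have h3 : 2⁻¹ * Z + 2⁻¹ * Z ≤ 2⁻¹ * Z + R * ((2 * R) ^ (r - 2) * Y) := h1 ▸ hZle
      exact (ENNReal.add_le_add_iff_left (ENNReal.mul_ne_top (by simp) hZtop)).1 h3
    calc Z = 2 * (2⁻¹ * Z) := by
          rw [← mul_assoc, ENNReal.mul_inv_cancel (by simp) (by simp), one_mul]
      _ ≤ _ := by gcongr
  calc _ ≤ ENNReal.ofReal r * Z := hint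
    _ ≤ ENNReal.ofReal r * (2 * (R * ((2 * R) ^ (r - 2) * Y))) := by gcongr
    _ = _ := by ring

open scoped Classical in
lemma exists_lintegral_sum_rpow_le {X ι : Type*} [MeasurableSpace X] {r : ℝ} (hr : 1 < r) :
    ∃ C : ℝ≥0∞, C ≠ ∞ ∧ ∀ (μ : Measure X) (T : Finset ι) (B : ι → Set X) (h : ι → ℝ)
      (c : ι → ℝ≥0∞), (∀ i ∈ T, MeasurableSet (B i)) →
      (∀ i ∈ T, ∀ j ∈ T, h j ≤ h i → B j ⊆ B i ∨ Disjoint (B j) (B i)) →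
      (∀ i ∈ T, μ (B i) ≠ 0) → (∀ i ∈ T, μ (B i) ≠ ∞) → (∀ i ∈ T, c i ≠ ∞) →
      ∫⁻ x, (∑ i ∈ T, c i * (B i).indicator (fun _ => (1 : ℝ≥0∞)) x) ^ r ∂μ ≤
        C * ∑ i ∈ T, c i * (μ (B i) *
          ((μ (B i))⁻¹ * ∑ j ∈ T with B j ⊆ B i, c j * μ (B j)) ^ (r - 1)) := by
  rcases le_or_gt r 2 with h2 | h2
  · exact ⟨_, ENNReal.ofReal_ne_top, fun μ T B h c hB hnest hμ0 hμ _ =>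
      lintegral_sum_rpow_le_of_le_two hr h2 μ T B h c hB hnest hμ0 hμ⟩
  · refine ⟨_, ?_, fun μ T B h c hB hnest hμ0 hμ hc =>
      lintegral_sum_rpow_le_of_two_lt h2 μ T B h c hB hnest hμ0 hμ hc⟩
    have : (2 * ENNReal.ofReal (r - 1)) ^ (r - 2) ≠ ∞ :=
      ENNReal.rpow_ne_top_of_nonneg (by linarith) (ENNReal.mul_ne_top (by simp) (by simp))
    exact ENNReal.mul_ne_top (by simp) (ENNReal.mul_ne_top (by simp)
      (ENNReal.mul_ne_top (by simp) this))

lemma exists_one_lt_mul_le_one {κ : Type*} [Finite κ] (q : κ → ℝ) (hq1 : ∀ k, q k < 1) :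
    ∃ θ : ℝ, 1 < θ ∧ ∀ k, θ * q k ≤ 1 := by
  have h : ∀ᶠ θ in nhdsWithin (1 : ℝ) (Ioi 1), ∀ k, θ * q k ≤ 1 := by
    refine Filter.eventually_all.2 fun k => nhdsWithin_le_nhds ?_
    have hc : ContinuousAt (fun θ : ℝ => θ * q k) 1 := by fun_prop
    exact (hc.eventually_lt_const (by simpa using hq1 k)).mono fun _ h => h.le
  obtain ⟨θ, h1, h2⟩ := (h.and self_mem_nhdsWithin).exists
  exact ⟨θ, h2, h1⟩

lemma prod_erase_mul_rpow_eq {κ : Type*} [Fintype κ] [DecidableEq κ] (n : κ) {q : κ → ℝ} {r θ : ℝ}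
    (hr : 1 ≤ r) (hrq : r * q n = 1) (hθ : θ * (r - 1) ≤ r) (a : κ → ℝ≥0∞) (ha0 : ∀ k, a k ≠ 0)
    (ha : ∀ k, a k ≠ ∞) :
    (∏ k ∈ Finset.univ.erase n, a k) * a n * ((a n)⁻¹ * ∏ k, a k ^ (1 - θ * q k)) ^ (r - 1) =
      (∏ k, a k ^ q k) ^ (r - θ * (r - 1)) *
        ∏ k ∈ Finset.univ.erase n, a k ^ (r * (1 - q k)) := by
  have hr' : 0 ≤ r - 1 := by linarith
  have hθ' : 0 ≤ r - θ * (r - 1) := by linarith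
  have h1 : ∏ k ∈ Finset.univ.erase n, a k ^ (1 + (1 - θ * q k) * (r - 1)) =
      (∏ k ∈ Finset.univ.erase n, a k) *
        (∏ k ∈ Finset.univ.erase n, a k ^ (1 - θ * q k)) ^ (r - 1) := by
    rw [← ENNReal.prod_rpow_of_nonneg hr', ← Finset.prod_mul_distrib]
    refine Finset.prod_congr rfl fun k _ => ?_
    rw [ENNReal.rpow_add _ _ (ha0 k) (ha k), ENNReal.rpow_one, ENNReal.rpow_mul]
  have h2 : ∏ k ∈ Finset.univ.erase n, a k ^ (1 + (1 - θ * q k) * (r - 1)) =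
      (∏ k ∈ Finset.univ.erase n, a k ^ q k) ^ (r - θ * (r - 1)) *
        ∏ k ∈ Finset.univ.erase n, a k ^ (r * (1 - q k)) := by
    rw [← ENNReal.prod_rpow_of_nonneg hθ', ← Finset.prod_mul_distrib]
    refine Finset.prod_congr rfl fun k _ => ?_
    rw [← ENNReal.rpow_mul, ← ENNReal.rpow_add _ _ (ha0 k) (ha k)]
    congr 1; ring
  have h3 : a n * ((a n)⁻¹ * a n ^ (1 - θ * q n)) ^ (r - 1) =
      (a n ^ q n) ^ (r - θ * (r - 1)) := by
    nth_rewrite 1 [← ENNReal.rpow_one (a n)]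
    rw [← ENNReal.rpow_neg_one, ← ENNReal.rpow_add _ _ (ha0 n) (ha n), ← ENNReal.rpow_mul,
      ← ENNReal.rpow_mul, ← ENNReal.rpow_add _ _ (ha0 n) (ha n)]
    congr 1
    linear_combination (-1 : ℝ) * hrq
  rw [← Finset.mul_prod_erase _ (fun k => a k ^ (1 - θ * q k)) (Finset.mem_univ n),
    ← Finset.mul_prod_erase _ (fun k => a k ^ q k) (Finset.mem_univ n), ← mul_assoc,
    ENNReal.mul_rpow_of_nonneg _ _ hr', ENNReal.mul_rpow_of_nonneg _ _ hθ', ← h3,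
    mul_assoc _ _ (∏ k ∈ Finset.univ.erase n, a k ^ (r * (1 - q k))), ← h2, h1]
  ring

/-- The weighted estimate for a finite nested sparse family, with abstract averages `a k i`. -/
lemma exists_lintegral_sum_prod_rpow_le {X ι κ : Type*} [MeasurableSpace X] [Fintype κ]
    [DecidableEq κ] (n : κ) {q : κ → ℝ} (hq0 : ∀ k, 0 < q k) (hq1 : ∀ k, q k < 1)
    (hq : ∑ k, (1 - q k) = 1) {r : ℝ} (hrq : r * q n = 1) :
    ∃ C : ℝ≥0∞, C ≠ ∞ ∧ ∀ (μ : Measure X) (ν : κ → Measure X) (T : Finset ι) (B E : ι → Set X)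
      (h : ι → ℝ) (a : κ → ι → ℝ≥0∞) (A : ℝ≥0∞),
      (∀ i ∈ T, MeasurableSet (B i)) → (∀ i ∈ T, MeasurableSet (E i)) →
      (∀ i ∈ T, E i ⊆ B i) → ((T : Set ι).PairwiseDisjoint E) →
      (∀ i ∈ T, μ (B i) ≤ 2 * μ (E i)) →
      (∀ i ∈ T, ∀ j ∈ T, h j ≤ h i → B j ⊆ B i ∨ Disjoint (B j) (B i)) →
      (∀ i ∈ T, μ (B i) ≠ 0) → (∀ i ∈ T, μ (B i) ≠ ∞) →
      (∀ k, ∀ i ∈ T, ν k (B i) = a k i * μ (B i)) →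
      (∀ k, ∀ i ∈ T, a k i ≠ 0) → (∀ k, ∀ i ∈ T, a k i ≠ ∞) →
      (∀ i ∈ T, ∏ k, a k i ^ q k ≤ A) →
      ∫⁻ x, (∑ i ∈ T, (∏ k ∈ Finset.univ.erase n, a k i) *
          (B i).indicator (fun _ => (1 : ℝ≥0∞)) x) ^ r ∂(ν n) ≤
        C * (A ^ r * ∑ i ∈ T,
          (∏ k ∈ Finset.univ.erase n, a k i ^ (r * (1 - q k))) * μ (B i)) := by
  classical
  have : Nonempty κ := ⟨n⟩
  obtain ⟨θ, hθ1, hθ⟩ := exists_one_lt_mul_le_one (Sum.elim q fun k => 1 - q k)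
    (Sum.forall.2 ⟨hq1, fun k => by simpa using hq0 k⟩)
  have hθq : ∀ k, θ * q k ≤ 1 := fun k => hθ (Sum.inl k)
  have hθn : θ * (1 - q n) ≤ 1 := hθ (Sum.inr n)
  have hr1 : 1 < r := by nlinarith [hq0 n, hq1 n]
  have hθr : θ * (r - 1) ≤ r := by
    have : r - 1 = r * (1 - q n) := by linear_combination hrq
    rw [this]
    nlinarith
  have hγ : ∀ k, 0 ≤ 1 - θ * q k := fun k => by linarith [hθq k]
  have hγ1 : ∑ k, (1 - θ * q k) < 1 := by
    have h1 : 0 < ∑ k, q k := Finset.sum_pos (fun k _ => hq0 k) Finset.univ_nonempty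
    have h2 : ∑ k, (1 - θ * q k) = ∑ k, (1 - q k) - (θ - 1) * ∑ k, q k := by
      rw [Finset.mul_sum, ← Finset.sum_sub_distrib]
      exact Finset.sum_congr rfl fun k _ => by ring
    rw [h2, hq]
    nlinarith
  obtain ⟨C1, hC1, H1⟩ := exists_lintegral_sum_rpow_le (X := X) (ι := ι) hr1
  obtain ⟨C2, hC2, H2⟩ := exists_sum_prod_rpow_average_le (X := X) (ι := ι) hγ hγ1
  refine ⟨C1 * C2 ^ (r - 1), ENNReal.mul_ne_top hC1
    (ENNReal.rpow_ne_top_of_nonneg (by linarith) hC2), ?_⟩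
  intro μ ν T B E h a A hB hE hEB hdisj hsp hnest hμ0 hμ hν ha0 ha hA
  have hνn0 : ∀ i ∈ T, ν n (B i) ≠ 0 := fun i hi => by
    rw [hν n i hi]; exact mul_ne_zero (ha0 n i hi) (hμ0 i hi)
  have hνn : ∀ i ∈ T, ν n (B i) ≠ ∞ := fun i hi => by
    rw [hν n i hi]; exact ENNReal.mul_ne_top (ha n i hi) (hμ i hi)
  refine (H1 (ν n) T B h (fun i => ∏ k ∈ Finset.univ.erase n, a k i) hB hnest hνn0 hνn
    fun i hi => ENNReal.prod_ne_top fun k _ => ha k i hi).trans ?_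
  have hlocal : ∀ i ∈ T, (ν n (B i))⁻¹ * ∑ j ∈ T with B j ⊆ B i,
      (∏ k ∈ Finset.univ.erase n, a k j) * ν n (B j) ≤
      C2 * A ^ θ * ((a n i)⁻¹ * ∏ k, a k i ^ (1 - θ * q k)) := by
    intro i hi
    have hT : ∀ j ∈ T.filter (fun j => B j ⊆ B i), j ∈ T := fun j hj => (Finset.mem_filter.1 hj).1
    calc (ν n (B i))⁻¹ * ∑ j ∈ T with B j ⊆ B i, (∏ k ∈ Finset.univ.erase n, a k j) * ν n (B j)
        ≤ (ν n (B i))⁻¹ * ∑ j ∈ T with B j ⊆ B i,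
            A ^ θ * ((∏ k, a k j ^ (1 - θ * q k)) * μ (B j)) := by
          refine mul_le_mul_right (Finset.sum_le_sum fun j hj => ?_) _
          rw [hν n j (hT j hj), ← mul_assoc, ← mul_assoc, Finset.prod_erase_mul _ _
            (Finset.mem_univ n)]
          gcongr
          calc ∏ k, a k j = (∏ k, a k j ^ q k) ^ θ * ∏ k, a k j ^ (1 - θ * q k) := by
                rw [← ENNReal.prod_rpow_of_nonneg (by linarith), ← Finset.prod_mul_distrib]
                refine Finset.prod_congr rfl fun k _ => ?_
                rw [← ENNReal.rpow_mul, ← ENNReal.rpow_add _ _ (ha0 k j (hT j hj))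
                  (ha k j (hT j hj)), show q k * θ + (1 - θ * q k) = 1 by ring, ENNReal.rpow_one]
            _ ≤ A ^ θ * ∏ k, a k j ^ (1 - θ * q k) := by
                gcongr
                exact hA j (hT j hj)
      _ ≤ (ν n (B i))⁻¹ * (A ^ θ * (C2 * ((∏ k, a k i ^ (1 - θ * q k)) * μ (B i)))) := by
          rw [← Finset.mul_sum]
          gcongr
          exact H2 μ ν _ B E h (B i) a (fun k => a k i) (fun j hj => hB j (hT j hj))
            (fun j hj => hE j (hT j hj)) (fun j hj => hEB j (hT j hj))
            (hdisj.subset fun j hj => hT j hj) (fun j hj => hsp j (hT j hj))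
            (fun j hj l hl => hnest j (hT j hj) l (hT l hl))
            (fun j hj => (Finset.mem_filter.1 hj).2) (fun k j hj => hν k j (hT j hj))
            (fun k => (hν k i hi).le) (fun k j hj => ha k j (hT j hj)) (fun k => ha0 k i hi)
            (fun k => ha k i hi)
      _ = C2 * A ^ θ * ((a n i)⁻¹ * ∏ k, a k i ^ (1 - θ * q k)) * ((μ (B i))⁻¹ * μ (B i)) := by
          rw [hν n i hi, ENNReal.mul_inv (Or.inl (ha0 n i hi)) (Or.inl (ha n i hi))]
          ring
      _ = _ := by rw [ENNReal.inv_mul_cancel (hμ0 i hi) (hμ i hi), mul_one]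
  rw [mul_assoc]
  refine mul_le_mul_right ?_ _
  rw [Finset.mul_sum, Finset.mul_sum]
  refine Finset.sum_le_sum fun i hi => ?_
  calc (∏ k ∈ Finset.univ.erase n, a k i) * (ν n (B i) * ((ν n (B i))⁻¹ *
          ∑ j ∈ T with B j ⊆ B i, (∏ k ∈ Finset.univ.erase n, a k j) * ν n (B j)) ^ (r - 1))
      ≤ (∏ k ∈ Finset.univ.erase n, a k i) * (ν n (B i) *
          (C2 * A ^ θ * ((a n i)⁻¹ * ∏ k, a k i ^ (1 - θ * q k))) ^ (r - 1)) := by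
        exact mul_le_mul_right (mul_le_mul_right
          (ENNReal.rpow_le_rpow (hlocal i hi) (by linarith)) _) _
    _ = C2 ^ (r - 1) * (A ^ θ) ^ (r - 1) * (((∏ k ∈ Finset.univ.erase n, a k i) * a n i *
          ((a n i)⁻¹ * ∏ k, a k i ^ (1 - θ * q k)) ^ (r - 1)) * μ (B i)) := by
        rw [hν n i hi, ENNReal.mul_rpow_of_nonneg _ _ (by linarith),
          ENNReal.mul_rpow_of_nonneg _ _ (by linarith)]
        ring
    _ = C2 ^ (r - 1) * (A ^ θ) ^ (r - 1) * (((∏ k, a k i ^ q k) ^ (r - θ * (r - 1)) *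
        ∏ k ∈ Finset.univ.erase n, a k i ^ (r * (1 - q k))) * μ (B i)) := by
        rw [prod_erase_mul_rpow_eq n hr1.le hrq hθr _ (fun k => ha0 k i hi) fun k => ha k i hi]
    _ ≤ C2 ^ (r - 1) * (A ^ θ) ^ (r - 1) * ((A ^ (r - θ * (r - 1)) *
        ∏ k ∈ Finset.univ.erase n, a k i ^ (r * (1 - q k))) * μ (B i)) := by
        gcongr
        exact hA i hi
    _ = C2 ^ (r - 1) * (A ^ r * ((∏ k ∈ Finset.univ.erase n, a k i ^ (r * (1 - q k))) *
        μ (B i))) := by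
        have : A ^ r = (A ^ θ) ^ (r - 1) * A ^ (r - θ * (r - 1)) := by
          rw [← ENNReal.rpow_mul, ← ENNReal.rpow_add_of_nonneg _ _ (by nlinarith) (by linarith)]
          congr 1; ring
        rw [this]
        ring

/-- Passage to countable families that split into two nested subfamilies. -/
lemma exists_lintegral_tsum_prod_rpow_le {X ι κ : Type*} [MeasurableSpace X]
    [Fintype κ] [DecidableEq κ] (n : κ) {q : κ → ℝ} (hq0 : ∀ k, 0 < q k) (hq1 : ∀ k, q k < 1)
    (hq : ∑ k, (1 - q k) = 1) {r : ℝ} (hrq : r * q n = 1) :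
    ∃ C : ℝ≥0∞, C ≠ ∞ ∧ ∀ (μ : Measure X) (ν : κ → Measure X) (S : Set ι) (B E : ι → Set X)
      (h : ι → ℝ) (P : ι → Prop) (a : κ → ι → ℝ≥0∞) (A : ℝ≥0∞), S.Countable →
      (∀ i ∈ S, MeasurableSet (B i)) → (∀ i ∈ S, MeasurableSet (E i)) →
      (∀ i ∈ S, E i ⊆ B i) → S.PairwiseDisjoint E →
      (∀ i ∈ S, μ (B i) ≤ 2 * μ (E i)) →
      (∀ i ∈ S, ∀ j ∈ S, (P i ↔ P j) → h j ≤ h i → B j ⊆ B i ∨ Disjoint (B j) (B i)) →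
      (∀ i ∈ S, μ (B i) ≠ 0) → (∀ i ∈ S, μ (B i) ≠ ∞) →
      (∀ k, ∀ i ∈ S, ν k (B i) = a k i * μ (B i)) →
      (∀ k, ∀ i ∈ S, a k i ≠ 0) → (∀ k, ∀ i ∈ S, a k i ≠ ∞) →
      (∀ i ∈ S, ∏ k, a k i ^ q k ≤ A) →
      ∫⁻ x, (∑' i : S, (∏ k ∈ Finset.univ.erase n, a k i) *
          (B i).indicator (fun _ => (1 : ℝ≥0∞)) x) ^ r ∂(ν n) ≤
        C * (A ^ r * ∑' i : S,
          (∏ k ∈ Finset.univ.erase n, a k i ^ (r * (1 - q k))) * μ (B i)) := by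
  classical
  have hr1 : 1 < r := by nlinarith [hq0 n, hq1 n]
  obtain ⟨C, hC, H⟩ := exists_lintegral_sum_prod_rpow_le (X := X) (ι := ι) n hq0 hq1 hq hrq
  refine ⟨2 ^ (r - 1) * (C + C), ENNReal.mul_ne_top
    (ENNReal.rpow_ne_top_of_nonneg (by linarith) (by simp)) (by simp [hC]), ?_⟩
  intro μ ν S B E h P a A hS hB hE hEB hdisj hsp hnest hμ0 hμ hν ha0 ha hA
  have := hS.to_subtype
  set f : S → X → ℝ≥0∞ := fun i x => (∏ k ∈ Finset.univ.erase n, a k i) *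
    (B i).indicator (fun _ => (1 : ℝ≥0∞)) x
  have hfm : ∀ i, Measurable (f i) := fun i =>
    (measurable_const.indicator (hB i i.2)).const_mul _
  set Y : ℝ≥0∞ := ∑' i : S, (∏ k ∈ Finset.univ.erase n, a k i ^ (r * (1 - q k))) * μ (B i)
  have hclass : ∀ T : Finset S, (∀ i ∈ T, ∀ j ∈ T, (P i ↔ P j)) →
      ∫⁻ x, (∑ i ∈ T, f i x) ^ r ∂(ν n) ≤ C * (A ^ r * Y) := by
    intro T hT
    have hTS : ∀ i ∈ T.map (Function.Embedding.subtype _), i ∈ S := fun i hi => by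
      obtain ⟨j, -, rfl⟩ := Finset.mem_map.1 hi
      exact j.2
    have hTP : ∀ i ∈ T.map (Function.Embedding.subtype _),
        ∀ j ∈ T.map (Function.Embedding.subtype _), (P i ↔ P j) := fun i hi j hj => by
      obtain ⟨i', hi', rfl⟩ := Finset.mem_map.1 hi
      obtain ⟨j', hj', rfl⟩ := Finset.mem_map.1 hj
      exact hT i' hi' j' hj'
    have key := H μ ν (T.map (Function.Embedding.subtype _)) B E h a A
      (fun i hi => hB i (hTS i hi)) (fun i hi => hE i (hTS i hi)) (fun i hi => hEB i (hTS i hi))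
      (hdisj.subset fun i hi => hTS i hi) (fun i hi => hsp i (hTS i hi))
      (fun i hi j hj => hnest i (hTS i hi) j (hTS j hj) (hTP i hi j hj))
      (fun i hi => hμ0 i (hTS i hi)) (fun i hi => hμ i (hTS i hi))
      (fun k i hi => hν k i (hTS i hi)) (fun k i hi => ha0 k i (hTS i hi))
      (fun k i hi => ha k i (hTS i hi)) fun i hi => hA i (hTS i hi)
    simp only [Finset.sum_map, Function.Embedding.subtype_apply] at key
    refine key.trans ?_
    gcongr
    exact ENNReal.sum_le_tsum T
  have hfin : ∀ T : Finset S, ∫⁻ x, (∑ i ∈ T, f i x) ^ r ∂(ν n) ≤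
      2 ^ (r - 1) * (C + C) * (A ^ r * Y) := by
    intro T
    let R : S → Prop := fun i => P i
    have hm : ∀ U : Finset S, Measurable fun x => (∑ i ∈ U, f i x) ^ r := fun U =>
      (Finset.measurable_fun_sum _ fun i _ => hfm i).pow_const _
    calc ∫⁻ x, (∑ i ∈ T, f i x) ^ r ∂(ν n)
        ≤ ∫⁻ x, 2 ^ (r - 1) * ((∑ i ∈ T with R i, f i x) ^ r +
            (∑ i ∈ T with ¬ R i, f i x) ^ r) ∂(ν n) := by
          refine lintegral_mono fun x => ?_
          rw [← Finset.sum_filter_add_sum_filter_not T R]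
          exact ENNReal.rpow_add_le_mul_rpow_add_rpow _ _ hr1.le
      _ = 2 ^ (r - 1) * (∫⁻ x, (∑ i ∈ T with R i, f i x) ^ r ∂(ν n) +
            ∫⁻ x, (∑ i ∈ T with ¬ R i, f i x) ^ r ∂(ν n)) := by
          rw [lintegral_const_mul' _ _ (ENNReal.rpow_ne_top_of_nonneg (by linarith) (by simp)),
            lintegral_add_left (hm _)]
      _ ≤ 2 ^ (r - 1) * (C * (A ^ r * Y) + C * (A ^ r * Y)) := by
          gcongr
          · exact hclass _ fun i hi j hj => iff_of_true (Finset.mem_filter.1 hi).2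
              (Finset.mem_filter.1 hj).2
          · exact hclass _ fun i hi j hj => iff_of_false (Finset.mem_filter.1 hi).2
              (Finset.mem_filter.1 hj).2
      _ = _ := by ring
  have hsup : ∀ x, (∑' i, f i x) ^ r = ⨆ T : Finset S, (∑ i ∈ T, f i x) ^ r := by
    intro x
    rw [ENNReal.tsum_eq_iSup_sum]
    exact (ENNReal.orderIsoRpow r (by linarith)).map_iSup _
  change ∫⁻ x, (∑' i, f i x) ^ r ∂(ν n) ≤ _
  simp_rw [hsup]
  rw [lintegral_iSup_directed_of_measurable
    (fun T => (Finset.measurable_fun_sum _ fun i _ => hfm i).pow_const _)]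
  · exact iSup_le hfin
  · refine Monotone.directed_le fun T U hTU x => ?_
    exact ENNReal.rpow_le_rpow (Finset.sum_le_sum_of_subset hTU) (by linarith)

lemma Cube.set_eq_pi (Q : Cube d) :
    Q.set = univ.pi fun i => Ico (Q.corner i) (Q.corner i + Q.side) := by
  ext x; simp [Cube.set, Set.mem_pi]

lemma Cube.measurableSet_set (Q : Cube d) : MeasurableSet Q.set := by
  rw [Q.set_eq_pi]
  exact MeasurableSet.univ_pi fun _ => measurableSet_Ico

lemma Cube.volume_set (Q : Cube d) : volume Q.set = ENNReal.ofReal Q.side ^ d := by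
  rw [Q.set_eq_pi, Real.volume_pi_Ico]
  simp

lemma Cube.volume_set_ne_zero (Q : Cube d) : volume Q.set ≠ 0 := by
  rw [Q.volume_set]
  exact pow_ne_zero _ (by simpa using Q.side_pos)

lemma Cube.volume_set_ne_top (Q : Cube d) : volume Q.set ≠ ∞ := by
  rw [Q.volume_set]
  exact ENNReal.pow_ne_top ENNReal.ofReal_ne_top

lemma countable_dyadicGrid (α : Rd d) : (dyadicGrid d α).Countable := by
  let g : ℤ × (Fin d → ℤ) → Cube d := fun jk =>
    ⟨fun i => (2 : ℝ) ^ (-jk.1) * (α i + jk.2 i), (2 : ℝ) ^ (-jk.1), by positivity⟩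
  refine (countable_range g).mono ?_
  rintro ⟨c, s, hs⟩ ⟨j, k, h1, h2⟩
  simp only at h1 h2
  subst h1
  obtain rfl : c = fun i => (2 : ℝ) ^ (-j) * (α i + k i) := funext h2
  exact ⟨(j, k), rfl⟩

lemma exists_four_pow_mul_add_eq {x : ℝ} (hx : x = 0 ∨ x = 1 / 3 ∨ x = 2 / 3) (l : ℕ) (k : ℤ) :
    ∃ K : ℤ, (4 : ℝ) ^ l * (x + k) = x + K := by
  induction l with
  | zero => exact ⟨k, by simp⟩
  | succ l ih =>
    obtain ⟨K, hK⟩ := ih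
    rw [pow_succ', mul_assoc, hK]
    rcases hx with rfl | rfl | rfl
    · exact ⟨4 * K, by push_cast; ring⟩
    · exact ⟨4 * K + 1, by push_cast; ring⟩
    · exact ⟨4 * K + 2, by push_cast; ring⟩

/-- Cubes of `dyadicGrid d α` whose side lengths differ by a power of `4` are nested or disjoint. -/
lemma subset_or_disjoint_of_mem_dyadicGrid {α : Rd d} (hα : ∀ i, α i = 0 ∨ α i = 1 / 3 ∨ α i = 2 / 3)
    {Q R : Cube d} (hQ : Q ∈ dyadicGrid d α) (hR : R ∈ dyadicGrid d α) {l : ℕ}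
    (hl : Q.side = R.side * 4 ^ l) : R.set ⊆ Q.set ∨ Disjoint R.set Q.set := by
  obtain ⟨j, k, hj, hk⟩ := hQ
  obtain ⟨j', k', hj', hk'⟩ := hR
  refine or_iff_not_imp_right.2 fun hd => ?_
  obtain ⟨x, hxR, hxQ⟩ := not_disjoint_iff.1 hd
  have hs := R.side_pos
  intro y hy i
  obtain ⟨K, hK⟩ := exists_four_pow_mul_add_eq (hα i) l (k i)
  have hcQ : Q.corner i = R.side * (α i + K) := by
    rw [hk i, ← hj, hl, mul_assoc, hK]
  have hcR : R.corner i = R.side * (α i + k' i) := by rw [hk' i, ← hj']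
  have hQs : Q.side = R.side * ((4 ^ l : ℤ) : ℝ) := by rw [hl]; push_cast; ring
  have h1 := hxR i
  have h2 := hxQ i
  have h3 := hy i
  rw [hcR] at h1 h3
  rw [hcQ, hQs] at h2 ⊢
  have hle1 : K < k' i + 1 := by
    have : R.side * (K : ℝ) < R.side * (k' i + 1) := by nlinarith
    exact_mod_cast lt_of_mul_lt_mul_left this hs.le
  have hle2 : k' i < K + 4 ^ l := by
    have : R.side * (k' i : ℝ) < R.side * (K + ((4 ^ l : ℤ) : ℝ)) := by nlinarith
    exact_mod_cast lt_of_mul_lt_mul_left this hs.le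
  have hle1' : (K : ℝ) ≤ k' i := by exact_mod_cast Int.lt_add_one_iff.1 hle1
  have hle2' : (k' i : ℝ) + 1 ≤ K + ((4 ^ l : ℤ) : ℝ) := by exact_mod_cast hle2
  have h4 := mul_le_mul_of_nonneg_left hle1' hs.le
  have h5 := mul_le_mul_of_nonneg_left hle2' hs.le
  constructor <;> nlinarith

lemma exists_side_eq_mul_four_pow {α : Rd d} {Q R : Cube d} (hQ : Q ∈ dyadicGrid d α)
    (hR : R ∈ dyadicGrid d α)
    (hP : (∃ l : ℤ, Q.side = (4 : ℝ) ^ l) ↔ ∃ l : ℤ, R.side = (4 : ℝ) ^ l)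
    (hle : R.side ≤ Q.side) : ∃ l : ℕ, Q.side = R.side * 4 ^ l := by
  obtain ⟨j, -, hj, -⟩ := hQ
  obtain ⟨j', -, hj', -⟩ := hR
  have key : ∀ t : ℤ, (∃ l : ℤ, (2 : ℝ) ^ (-t) = (4 : ℝ) ^ l) ↔ Even t := by
    intro t
    have h4 : ∀ l : ℤ, (4 : ℝ) ^ l = 2 ^ (2 * l) := fun l => by
      rw [zpow_mul]; norm_num
    constructor
    · rintro ⟨l, hl⟩
      rw [h4] at hl
      have := zpow_right_injective₀ (a := (2 : ℝ)) (by norm_num) (by norm_num) hl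
      exact ⟨-l, by omega⟩
    · rintro ⟨l, rfl⟩
      exact ⟨-l, by rw [h4]; congr 1; ring⟩
  rw [hj, hj', key, key] at hP
  rw [hj, hj'] at hle
  have hjj : j ≤ j' := by
    have := (zpow_le_zpow_iff_right₀ (a := (2 : ℝ)) (by norm_num)).1 hle
    omega
  obtain ⟨l, hl⟩ : ∃ l : ℕ, j' = j + 2 * l := by
    have : Even (j' - j) := by rw [Int.even_sub]; tauto
    obtain ⟨l, hl⟩ := this
    exact ⟨l.toNat, by omega⟩
  refine ⟨l, ?_⟩
  rw [hj, hj', hl, show (4 : ℝ) ^ l = 2 ^ (2 * (l : ℤ)) by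
    rw [zpow_mul, zpow_natCast]; norm_num, ← zpow_add₀ (by norm_num)]
  congr 1; ring

lemma prod_univ_erase_some {α M : Type*} [Fintype α] [DecidableEq α] [CommMonoid M] (n : α)
    (f : Option α → M) :
    ∏ k ∈ Finset.univ.erase (some n), f k = f none * ∏ j ∈ Finset.univ.erase n, f (some j) := by
  have : (Finset.univ.erase (some n) : Finset (Option α)) =
      Finset.insertNone (Finset.univ.erase n) := by
    ext k
    cases k <;> simp
  rw [this, Finset.prod_insertNone]

lemma avg_one (f : Rd d → ℝ) (Q : Cube d) :
    avg f 1 Q = (volume Q.set)⁻¹ * ∫⁻ x in Q.set, ofFn f x := by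
  simp [avg, eAvg]

lemma avg_one_mul_volume (f : Rd d → ℝ) (Q : Cube d) :
    avg f 1 Q * volume Q.set = ∫⁻ x in Q.set, ofFn f x := by
  rw [avg_one, mul_comm, ← mul_assoc,
    ENNReal.mul_inv_cancel Q.volume_set_ne_zero Q.volume_set_ne_top, one_mul]

lemma avg_one_ne_zero {f : Rd d → ℝ} (hf : AEMeasurable f) (hpos : ∀ᵐ x, 0 < f x) (Q : Cube d) :
    avg f 1 Q ≠ 0 := by
  intro h0
  have h1 := avg_one_mul_volume f Q
  have hm : AEMeasurable (ofFn f) := ENNReal.measurable_ofReal.comp_aemeasurable hf.norm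
  rw [h0, zero_mul, eq_comm, lintegral_eq_zero_iff' hm.restrict] at h1
  have h2 : ∀ᵐ x ∂(volume.restrict Q.set), False := by
    filter_upwards [h1, ae_restrict_of_ae hpos] with x hx hx'
    simp [ofFn] at hx
    exact hx'.ne' hx
  rw [Filter.eventually_false_iff_eq_bot, ae_eq_bot, Measure.restrict_eq_zero] at h2
  exact Q.volume_set_ne_zero h2

lemma avg_eq_avg_one_rpow {f g : Rd d → ℝ} {s : ℝ}
    (h : ∀ᵐ x, ofFn g x = ofFn f x ^ s) (Q : Cube d) :
    avg f s Q = avg g 1 Q ^ s⁻¹ := by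
  rw [avg_one, avg, eAvg, one_div,
    lintegral_congr_ae ((ae_restrict_of_ae h).mono fun x hx => hx.symm)]

lemma toReal_conj {x : ℝ≥0∞} (hx : 1 < x) :
    (conj x).toReal⁻¹ = 1 - x.toReal⁻¹ := by
  have : x⁻¹ ≤ 1 := ENNReal.inv_le_one.2 hx.le
  rw [conj, ENNReal.toReal_inv, inv_inv, ENNReal.toReal_sub_of_le this (by simp),
    ENNReal.toReal_inv]
  simp

lemma conj_ne_top {x : ℝ≥0∞} (hx : 1 < x) : conj x ≠ ∞ := by
  rw [conj, ENNReal.inv_ne_top]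
  exact (tsub_pos_of_lt (ENNReal.inv_lt_one.2 hx)).ne'

/-- A product bound controls each factor when no factor vanishes. -/
lemma ne_top_of_prod_rpow_ne_top {κ : Type*} [Fintype κ] [DecidableEq κ] {a : κ → ℝ≥0∞}
    {q : κ → ℝ} (hq : ∀ k, 0 < q k) (ha : ∀ k, a k ≠ 0) (h : ∏ k, a k ^ q k ≠ ∞) (k : κ) :
    a k ≠ ∞ := by
  intro hk
  rw [← Finset.mul_prod_erase _ _ (Finset.mem_univ k), hk, ENNReal.top_rpow_of_pos (hq k),
    ENNReal.top_mul] at h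
  · exact h rfl
  · refine Finset.prod_ne_zero_iff.2 fun j _ => ?_
    rw [Ne, ENNReal.rpow_eq_zero_iff_of_pos (hq j)]
    exact ha j

lemma IsWeight.aemeasurable {u : Rd d → ℝ} (hu : IsWeight u) : AEMeasurable u :=
  hu.1.aestronglyMeasurable.aemeasurable

lemma IsWeight.aemeasurable_rpow {u : Rd d → ℝ} (hu : IsWeight u) (s : ℝ) :
    AEMeasurable fun x => u x ^ s :=
  hu.aemeasurable.pow_const s

lemma IsWeight.rpow_pos {u : Rd d → ℝ} (hu : IsWeight u) (s : ℝ) :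
    ∀ᵐ x, 0 < u x ^ s :=
  hu.2.mono fun _ hx => Real.rpow_pos_of_pos hx s

lemma IsWeight.ofFn_rpow {u : Rd d → ℝ} (hu : IsWeight u) {s : ℝ} (hs : 0 ≤ s) :
    ∀ᵐ x, ofFn (fun y => u y ^ s) x = ofFn u x ^ s := by
  filter_upwards [hu.2] with x hx
  simp only [ofFn]
  rw [ENNReal.ofReal_rpow_of_nonneg (abs_nonneg _) hs, abs_of_pos hx,
    abs_of_pos (Real.rpow_pos_of_pos hx s)]

lemma IsWeight.ofFn_rpow_neg {u : Rd d → ℝ} (hu : IsWeight u) {s : ℝ} (hs : 0 ≤ s) :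
    ∀ᵐ x, ofFn (fun y => u y ^ (-s)) x = ofFn (fun y => (u y)⁻¹) x ^ s := by
  filter_upwards [hu.2] with x hx
  simp only [ofFn]
  rw [ENNReal.ofReal_rpow_of_nonneg (abs_nonneg _) hs, abs_of_pos (inv_pos.2 hx),
    abs_of_pos (Real.rpow_pos_of_pos hx _), Real.inv_rpow hx.le, Real.rpow_neg hx.le]

/-- Lemma: weighted bound for the sparse operator built from `v_0 = ω^p` and
`v_j = w_j^{-p_j'}`, `j = 1, …, m-1`, against the measure `v_m`. -/
theorem stmt7 (d m : ℕ) (hd : 1 ≤ d) (hm : 1 ≤ m)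
    (p : Fin m → ℝ≥0∞) (hp : ∀ j, 1 < p j ∧ p j ≠ ∞)
    (p0 : ℝ≥0∞) (hp0gt : 1 < p0) (hp0top : p0 ≠ ∞) (hp0 : p0⁻¹ = ∑ j, (p j)⁻¹) :
    ∃ c : ℝ≥0∞, c ≠ ∞ ∧
      ∀ D : Set (Cube d), IsDyadicGrid D →
      ∀ S : Set (Cube d), S ⊆ D → IsSparse (1/2) S →
      ∀ (w : Fin m → Rd d → ℝ) (ω : Rd d → ℝ),
        (∀ j, IsWeight (w j)) → IsWeight ω →
        APtw p0.toReal p w ω ≠ ∞ →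
        ∀ hlast : m - 1 < m,
          (∫⁻ x, (∑' Q : S,
                (avg (fun y => ω y ^ p0.toReal) 1 Q.1 *
                  ∏ j ∈ Finset.univ.erase (⟨m - 1, hlast⟩ : Fin m),
                    avg (vW p w j) 1 Q.1) *
                  (Q.1).set.indicator (fun _ => (1 : ℝ≥0∞)) x)
                ^ (conj (p ⟨m - 1, hlast⟩)).toReal *
              ENNReal.ofReal (vW p w ⟨m - 1, hlast⟩ x))
            ^ ((conj (p ⟨m - 1, hlast⟩)).toReal)⁻¹ ≤
          c * APtw p0.toReal p w ω *
            (∑' Q : S,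
                avg (fun y => ω y ^ p0.toReal) 1 Q.1
                    ^ ((conj (p ⟨m - 1, hlast⟩)).toReal / (conj p0).toReal) *
                  (∏ j ∈ Finset.univ.erase (⟨m - 1, hlast⟩ : Fin m),
                    avg (vW p w j) 1 Q.1
                      ^ ((conj (p ⟨m - 1, hlast⟩)).toReal / (p j).toReal)) *
                  volume (Q.1).set)
              ^ ((conj (p ⟨m - 1, hlast⟩)).toReal)⁻¹ := by
  obtain ⟨n, hn⟩ : ∃ n : Fin m, (n : ℕ) = m - 1 := ⟨⟨m - 1, by omega⟩, rfl⟩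
  have hn' : ∀ h : m - 1 < m, (⟨m - 1, h⟩ : Fin m) = n := fun h => Fin.ext hn.symm
  simp only [hn']
  have hpr : ∀ j, 1 < (p j).toReal := fun j =>
    (ENNReal.toReal_lt_toReal one_ne_top (hp j).2).2 (hp j).1
  have hp0r : 1 < p0.toReal := (ENNReal.toReal_lt_toReal one_ne_top hp0top).2 hp0gt
  have hsum : p0.toReal⁻¹ = ∑ j, (p j).toReal⁻¹ := by
    rw [← ENNReal.toReal_inv, hp0, ENNReal.toReal_sum fun j _ =>
      ENNReal.inv_ne_top.2 (zero_lt_one.trans (hp j).1).ne']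
    simp only [ENNReal.toReal_inv]
  let q : Option (Fin m) → ℝ := fun k => k.elim p0.toReal⁻¹ fun j => (conj (p j)).toReal⁻¹
  have hqn : q none = p0.toReal⁻¹ := rfl
  have hqs : ∀ j, q (some j) = (conj (p j)).toReal⁻¹ := fun j => rfl
  have hqs' : ∀ j, q (some j) = 1 - (p j).toReal⁻¹ := fun j => toReal_conj (hp j).1
  have hq0 : ∀ k, 0 < q k := by
    rintro (_ | j)
    · rw [hqn]; positivity
    · rw [hqs', sub_pos]; exact inv_lt_one_of_one_lt₀ (hpr j)
  have hq1 : ∀ k, q k < 1 := by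
    rintro (_ | j)
    · exact inv_lt_one_of_one_lt₀ hp0r
    · rw [hqs', sub_lt_self_iff]; exact inv_pos.2 (zero_lt_one.trans (hpr j))
  have hq : ∑ k, (1 - q k) = 1 := by
    rw [Fintype.sum_option]
    simp only [hqs', hqn, _root_.sub_sub_cancel, ← hsum, _root_.sub_add_cancel]
  set r : ℝ := (conj (p n)).toReal
  have hr0 : 0 < r := by
    have := hq0 (some n)
    rwa [hqs, inv_pos] at this
  have hrq : r * q (some n) = 1 := mul_inv_cancel₀ hr0.ne'
  obtain ⟨C, hC, H⟩ := exists_lintegral_tsum_prod_rpow_le (X := Rd d) (ι := Cube d) (some n)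
    hq0 hq1 hq hrq
  refine ⟨C ^ r⁻¹, ENNReal.rpow_ne_top_of_nonneg (by positivity) hC, ?_⟩
  rintro D ⟨α, hα, rfl⟩ S hSD ⟨E, hE, hEd⟩ w ω hw hω hA -
  set A := APtw p0.toReal p w ω
  let v : Option (Fin m) → Rd d → ℝ := fun k => k.elim (fun y => ω y ^ p0.toReal) (vW p w)
  let a : Option (Fin m) → Cube d → ℝ≥0∞ := fun k Q => avg (v k) 1 Q
  have hvm : ∀ k, AEMeasurable (v k) := by
    rintro (_ | j)
    · exact hω.aemeasurable_rpow _
    · exact (hw j).aemeasurable_rpow _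
  have hvpos : ∀ k, ∀ᵐ x, 0 < v k x := by
    rintro (_ | j)
    · exact hω.rpow_pos _
    · exact (hw j).rpow_pos _
  have hofm : ∀ k, AEMeasurable (ofFn (v k)) := fun k =>
    ENNReal.measurable_ofReal.comp_aemeasurable (hvm k).norm
  have ha0 : ∀ k Q, a k Q ≠ 0 := fun k Q => avg_one_ne_zero (hvm k) (hvpos k) Q
  have haA : ∀ Q, ∏ k, a k Q ^ q k ≤ A := by
    intro Q
    refine le_trans (le_of_eq ?_) (le_iSup _ Q)
    rw [Fintype.prod_option, avg_eq_avg_one_rpow (hω.ofFn_rpow (zero_lt_one.trans hp0r).le)]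
    congr 1
    refine Finset.prod_congr rfl fun j _ => ?_
    rw [avgE, if_neg (conj_ne_top (hp j).1),
      avg_eq_avg_one_rpow ((hw j).ofFn_rpow_neg ENNReal.toReal_nonneg)]
    rfl
  have ha : ∀ k Q, a k Q ≠ ∞ := fun k Q =>
    ne_top_of_prod_rpow_ne_top (a := fun k => a k Q) hq0 (fun k => ha0 k Q)
      (ne_top_of_le_ne_top hA (haA Q)) k
  have hSc : S.Countable := (countable_dyadicGrid α).mono hSD
  have key := H volume (fun k => volume.withDensity (ofFn (v k))) S Cube.set E Cube.side
    (fun Q => ∃ l : ℤ, Q.side = (4 : ℝ) ^ l) a A hSc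
    (fun Q _ => Q.measurableSet_set) (fun Q hQ => (hE Q hQ).2.1) (fun Q hQ => (hE Q hQ).1) hEd
    (fun Q hQ => by
      have h2 : (2 : ℝ≥0∞) * ENNReal.ofReal (1 / 2) = 1 := by
        rw [← ENNReal.ofReal_ofNat 2, ← ENNReal.ofReal_mul (by norm_num)]
        norm_num
      calc volume Q.set = 2 * (ENNReal.ofReal (1 / 2) * volume Q.set) := by
            rw [← mul_assoc, h2, one_mul]
        _ ≤ 2 * volume (E Q) := by
            gcongr
            exact (hE Q hQ).2.2)
    (fun Q hQ R hR hP hle => by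
      obtain ⟨l, hl⟩ := exists_side_eq_mul_four_pow (hSD hQ) (hSD hR) hP hle
      exact subset_or_disjoint_of_mem_dyadicGrid hα (hSD hQ) (hSD hR) hl)
    (fun Q _ => Q.volume_set_ne_zero) (fun Q _ => Q.volume_set_ne_top)
    (fun k Q _ => by
      rw [withDensity_apply _ Q.measurableSet_set]
      exact (avg_one_mul_volume _ _).symm)
    (fun k Q _ => ha0 k Q) (fun k Q _ => ha k Q) fun Q _ => haA Q
  simp only [prod_univ_erase_some] at key
  have hexp0 : r * (1 - q none) = r / (conj p0).toReal := by
    rw [div_eq_mul_inv, toReal_conj hp0gt, hqn]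
  have hexp : ∀ j, r * (1 - q (some j)) = r / (p j).toReal := fun j => by
    rw [div_eq_mul_inv, hqs', _root_.sub_sub_cancel]
  simp only [hexp0, hexp] at key
  have := hSc.to_subtype
  set F : Rd d → ℝ≥0∞ := fun x => ∑' Q : S,
    (a none Q * ∏ j ∈ Finset.univ.erase n, a (some j) Q) *
      (Q.1).set.indicator (fun _ => (1 : ℝ≥0∞)) x
  have hFm : Measurable F := Measurable.tsum fun Q =>
    (measurable_const.indicator (Cube.measurableSet_set Q.1)).const_mul _
  rw [lintegral_withDensity_eq_lintegral_mul₀ (hofm _) (hFm.pow_const r).aemeasurable] at key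
  have hle : ∫⁻ x, F x ^ r * ENNReal.ofReal (v (some n) x) ≤
      ∫⁻ x, (ofFn (v (some n)) * fun x => F x ^ r) x := by
    refine lintegral_mono fun x => ?_
    rw [Pi.mul_apply, mul_comm]
    gcongr
    exact ENNReal.ofReal_le_ofReal (le_abs_self _)
  refine (ENNReal.rpow_le_rpow (hle.trans key) (inv_pos.2 hr0).le).trans (le_of_eq ?_)
  rw [ENNReal.mul_rpow_of_nonneg _ _ (inv_pos.2 hr0).le,
    ENNReal.mul_rpow_of_nonneg _ _ (inv_pos.2 hr0).le, ENNReal.rpow_rpow_inv hr0.ne', ← mul_assoc]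
  rfl

end Paper
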